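/- Let C ⊆ ℝ^n be nonempty, convex and compact, let G : ℝ^n → ℝ^n be L-Lipschitz continuous with L > 0, let D be the diameter of C, and let 0 < ε ≤ D²L. Then for every x ∈ C, if ψ^M(x) ≤ ε then ψ^S(x) ≤ 2D√(Lε), where ψ^S(x) := sup{⟨G(x), x − y⟩ : y ∈ C} and ψ^M(x) := sup{⟨G(y), x − y⟩ : y ∈ C}. Equivalently, {x ∈ C : ψ^M(x) ≤ ε} ⊆ {x ∈ C : ψ^S(x) ≤ 2D√(Lε)}. -/

import Mathlib

open RealInnerProductSpace

/-- The Stampacchia gap function `ψ^S(x) = sup {⟪G x, x - y⟫ : y ∈ C}`. -/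
noncomputable def psiS {n : ℕ} (G : EuclideanSpace ℝ (Fin n) → EuclideanSpace ℝ (Fin n))
    (C : Set (EuclideanSpace ℝ (Fin n))) (x : EuclideanSpace ℝ (Fin n)) : ℝ :=
  sSup ((fun y => ⟪G x, x - y⟫) '' C)

/-- The Minty gap function `ψ^M(x) = sup {⟪G y, x - y⟫ : y ∈ C}`. -/
noncomputable def psiM {n : ℕ} (G : EuclideanSpace ℝ (Fin n) → EuclideanSpace ℝ (Fin n))
    (C : Set (EuclideanSpace ℝ (Fin n))) (x : EuclideanSpace ℝ (Fin n)) : ℝ :=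
  sSup ((fun y => ⟪G y, x - y⟫) '' C)

/-- For a convex set, an `L`-Lipschitz map whose Minty values at `x` are at most `ε` has Stampacchia
values at most `ε / t + L t D ^ 2`, for each step size `t ∈ (0, 1]`. -/
theorem inner_le_of_minty_le {E : Type*} [NormedAddCommGroup E] [InnerProductSpace ℝ E]
    {C : Set E} (hC : Convex ℝ C) {G : E → E} {L ε t D : ℝ} (hL : 0 ≤ L)
    (hG : ∀ u v, ‖G u - G v‖ ≤ L * ‖u - v‖) {x y : E} (hx : x ∈ C) (hy : y ∈ C)
    (hD : ‖x - y‖ ≤ D) (ht : 0 < t) (ht1 : t ≤ 1) (h : ∀ z ∈ C, ⟪G z, x - z⟫ ≤ ε) :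
    ⟪G x, x - y⟫ ≤ ε / t + L * t * D ^ 2 := by
  set z := x + t • (y - x) with hz
  have hxz : x - z = t • (x - y) := by rw [hz]; module
  have hzC : z ∈ C := hC.add_smul_sub_mem hx hy ⟨ht.le, ht1⟩
  have hminty : ⟪G z, x - y⟫ ≤ ε / t := by
    have := h z hzC
    rw [hxz, real_inner_smul_right] at this
    rwa [le_div_iff₀' ht]
  have hlip : ⟪G x - G z, x - y⟫ ≤ L * t * D ^ 2 :=
    calc ⟪G x - G z, x - y⟫ ≤ ‖G x - G z‖ * ‖x - y‖ := real_inner_le_norm _ _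
      _ ≤ L * ‖x - z‖ * ‖x - y‖ := by gcongr; exact hG x z
      _ = L * t * ‖x - y‖ ^ 2 := by
        rw [hxz, norm_smul, Real.norm_of_nonneg ht.le]; ring
      _ ≤ L * t * D ^ 2 := by gcongr
  rw [inner_sub_left] at hlip
  linarith

/-- If `G` is `L`-Lipschitz, `D = diam C` and `0 < ε ≤ D² L`, then for
every `x ∈ C`, `ψ^M(x) ≤ ε` implies `ψ^S(x) ≤ 2 D √(L ε)`. -/
theorem minty_eps_implies_stampacchia_bound {n : ℕ} (C : Set (EuclideanSpace ℝ (Fin n)))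
    (hne : C.Nonempty) (hconv : Convex ℝ C) (hcomp : IsCompact C)
    (G : EuclideanSpace ℝ (Fin n) → EuclideanSpace ℝ (Fin n))
    (L : ℝ) (hL : 0 < L)
    (hGlip : ∀ u v : EuclideanSpace ℝ (Fin n), ‖G u - G v‖ ≤ L * ‖u - v‖)
    (ε : ℝ) (hε : 0 < ε) (hεD : ε ≤ (Metric.diam C) ^ 2 * L) :
    ∀ x ∈ C, psiM G C x ≤ ε → psiS G C x ≤ 2 * Metric.diam C * Real.sqrt (L * ε) := by
  intro x hx hM
  have hGcont : Continuous G :=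
    (LipschitzWith.of_dist_le_mul (K := L.toNNReal) fun u v => by
      simpa only [dist_eq_norm, Real.coe_toNNReal L hL.le] using hGlip u v).continuous
  have hminty : ∀ z ∈ C, ⟪G z, x - z⟫ ≤ ε := fun z hz =>
    (le_csSup (hcomp.bddAbove_image (by fun_prop)) (Set.mem_image_of_mem _ hz)).trans hM
  have hD : 0 < Metric.diam C :=
    Metric.diam_nonneg.lt_of_ne fun h => by simp [← h] at hεD; linarith
  refine csSup_le (hne.image _) ?_
  rintro _ ⟨y, hy, rfl⟩
  have hxy : ‖x - y‖ ≤ Metric.diam C :=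
    dist_eq_norm x y ▸ Metric.dist_le_diam_of_mem hcomp.isBounded hx hy
  set D := Metric.diam C
  set s := √(L * ε)
  have hs : 0 < s := Real.sqrt_pos.2 (mul_pos hL hε)
  have hs2 : s ^ 2 = L * ε := Real.sq_sqrt (mul_pos hL hε).le
  have ht1 : s / (L * D) ≤ 1 := by
    rw [div_le_one (by positivity)]
    refine Real.sqrt_le_iff.2 ⟨by positivity, ?_⟩
    nlinarith
  refine (inner_le_of_minty_le hconv hL.le hGlip hx hy hxy (by positivity) ht1 hminty).trans_eq ?_
  field_simp
  linear_combination -hs2
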